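/- Let F(s) = ξ(2)·ξ(s+1)ξ(2s)ξ(3s)/(s−2) − ξ(2)·ξ(s−1)ξ(2s−1)ξ(3s−2)/(s+1) − ξ(s+1)ξ(2s)ξ(3s)/(2s−2) + ξ(s−1)ξ(2s−1)ξ(3s−2)/(2s) − ξ(s)ξ(2s)ξ(3s−1)/((3s)(2s−2)) − ξ(s)ξ(2s−1)ξ(3s−2)/((3s−1)(s−2)) − ξ(s)ξ(2s−1)ξ(3s−1)/((3s−3)(2s)) − ξ(s)ξ(2s)ξ(3s)/((3s−2)(s+1)). Then for every complex s with s ∉ {−1, 0, 1/3, 1/2, 2/3, 1, 2}, one has F(1−s) = F(s). -/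

import Mathlib

open Complex

local notation "ξ" => completedRiemannZeta

/-- Weng's zeta function `ξ_ℚ^{G₂/P_long}(s)`. -/
noncomputable def wengG2Plong (s : ℂ) : ℂ :=
  ξ 2 * ξ (s + 1) * ξ (2*s) * ξ (3*s) / (s - 2)
    - ξ 2 * ξ (s - 1) * ξ (2*s - 1) * ξ (3*s - 2) / (s + 1)
    - ξ (s + 1) * ξ (2*s) * ξ (3*s) / (2*s - 2)
    + ξ (s - 1) * ξ (2*s - 1) * ξ (3*s - 2) / (2*s)
    - ξ s * ξ (2*s) * ξ (3*s - 1) / ((3*s) * (2*s - 2))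
    - ξ s * ξ (2*s - 1) * ξ (3*s - 2) / ((3*s - 1) * (s - 2))
    - ξ s * ξ (2*s - 1) * ξ (3*s - 1) / ((3*s - 3) * (2*s))
    - ξ s * ξ (2*s) * ξ (3*s) / ((3*s - 2) * (s + 1))

/-- Functional equation for Weng's zeta of `(G₂, P_long)` over `ℚ`. -/
theorem wengG2Plong_functional_equation (s : ℂ)
    (hs : s ∉ ({-1, 0, 1/3, 1/2, 2/3, 1, 2} : Set ℂ)) :
    wengG2Plong (1 - s) = wengG2Plong s := by
  have reflect {a b : ℂ} (h : a = 1 - b) : ξ a = ξ b := by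
    rw [h, completedRiemannZeta_one_sub]
  unfold wengG2Plong
  rw [reflect (show 1 - s + 1 = 1 - (s - 1) by ring),
    reflect (show 2 * (1 - s) = 1 - (2*s - 1) by ring),
    reflect (show 3 * (1 - s) = 1 - (3*s - 2) by ring),
    reflect (show 1 - s - 1 = 1 - (s + 1) by ring),
    reflect (show 2 * (1 - s) - 1 = 1 - 2*s by ring),
    reflect (show 3 * (1 - s) - 2 = 1 - 3*s by ring),
    reflect (show 3 * (1 - s) - 1 = 1 - (3*s - 1) by ring),
    completedRiemannZeta_one_sub,
    show 1 - s - 2 = -(s + 1) by ring,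
    show 1 - s + 1 = -(s - 2) by ring,
    show 2 * (1 - s) - 2 = -(2*s) by ring,
    show 3 * (1 - s) - 1 = -(3*s - 2) by ring,
    show 3 * (1 - s) - 3 = -(3*s) by ring,
    show 3 * (1 - s) - 2 = -(3*s - 1) by ring,
    show 2 * (1 - s) = -(2*s - 2) by ring,
    show 3 * (1 - s) = -(3*s - 3) by ring]
  simp only [div_neg, neg_mul_neg]
  ring
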